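/- Let ℙ₀ be a probability measure on (Ω, ℱ), let 𝒳 × A be a finite index set, and let (γ_t(x,a), F_t(x,a), Δ_t(x,a))_{t∈ℕ₀}, (x,a) ∈ 𝒳 × A, be real-valued stochastic processes satisfying, for all t ∈ ℕ₀, Δ_{t+1}(x,a) = (1 − γ_t(x,a)) Δ_t(x,a) + γ_t(x,a) F_t(x,a) ℙ₀-almost surely for all (x,a). Let (𝒢_t)_{t∈ℕ₀} ⊆ ℱ be an increasing sequence of σ-algebras such that Δ₀(x,a) and γ₀(x,a) are 𝒢₀-measurable and, for all t ≥ 1, Δ_t(x,a), γ_t(x,a) and F_{t−1}(x,a) are 𝒢_t-measurable. Assume: (i) 0 ≤ γ_t(x,a) ≤ 1, Σ_{t=0}^∞ γ_t(x,a) = ∞ and Σ_{t=0}^∞ γ_t(x,a)² < ∞ ℙ₀-almost surely for all (x,a); (ii) there exists δ ∈ (0,1) with ‖E_{ℙ₀}[F_t(·,·) | 𝒢_t]‖_∞ ≤ δ ‖Δ_t‖_∞ ℙ₀-almost surely for all t; (iii) there exists C > 0 with ‖Var_{ℙ₀}(F_t(·,·) | 𝒢_t)‖_∞ ≤ C (1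 + ‖Δ_t‖_∞)² ℙ₀-almost surely for all t. Then lim_{t→∞} Δ_t(x,a) = 0 ℙ₀-almost surely for all (x,a) ∈ 𝒳 × A. -/

import Mathlib

/-!
Stochastic approximation lemma (Singh et al., Lemma 1), stated for a finite
index set `S × A`.  For a family `f : S × A → Ω → ℝ` the random sup norm is
`ω ↦ ⨆ p : S × A, |f p ω|`, and the conditional variance of `Z` given `𝒢` is
`E[Z² | 𝒢] − (E[Z | 𝒢])²`.
-/

open MeasureTheory Filter

theorem eventually_le_of_relaxation {y g : ℕ → ℝ} {c : ℝ} (hg : ∀ t, g t ∈ Set.Icc (0 : ℝ) 1)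
    (hsum : ¬ Summable g) (hy : ∀ᶠ t in atTop, y (t + 1) ≤ (1 - g t) * y t + g t * c)
    {ε : ℝ} (hε : 0 < ε) : ∀ᶠ t in atTop, y t ≤ c + ε := by
  obtain ⟨t₀, ht₀⟩ := eventually_atTop.1 hy
  have hsum' : ¬ Summable fun n => g (n + t₀) := fun h => hsum ((summable_nat_add_iff t₀).1 h)
  have htend := (not_summable_iff_tendsto_nat_atTop_of_nonneg fun n => (hg (n + t₀)).1).1 hsum'
  have hbound : ∀ n, y (n + t₀) - c ≤
      Real.exp (-∑ i ∈ Finset.range n, g (i + t₀)) * |y t₀ - c| := by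
    intro n
    induction n with
    | zero => simpa using le_abs_self (y t₀ - c)
    | succ n ih =>
      have h1 := ht₀ (n + t₀) (by omega)
      have h2 := hg (n + t₀)
      have h3 := Real.one_sub_le_exp_neg (g (n + t₀))
      rw [Finset.sum_range_succ, neg_add, Real.exp_add, show n + 1 + t₀ = n + t₀ + 1 by omega]
      set E := Real.exp (-∑ i ∈ Finset.range n, g (i + t₀)) * |y t₀ - c| with hE
      have hE0 : 0 ≤ E := by positivity
      calc y (n + t₀ + 1) - c ≤ (1 - g (n + t₀)) * (y (n + t₀) - c) := by linarith
        _ ≤ (1 - g (n + t₀)) * E := mul_le_mul_of_nonneg_left ih (by linarith [h2.2])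
        _ ≤ Real.exp (-g (n + t₀)) * E := mul_le_mul_of_nonneg_right h3 hE0
        _ = _ := by rw [hE]; ring
  have hlim : Tendsto (fun n => Real.exp (-∑ i ∈ Finset.range n, g (i + t₀)) * |y t₀ - c|)
      atTop (nhds 0) := by
    have := (Real.tendsto_exp_neg_atTop_nhds_zero.comp htend).mul_const |y t₀ - c|
    simpa using this
  refine (eventually_atTop.2 ?_)
  obtain ⟨n₀, hn₀⟩ := eventually_atTop.1 (hlim.eventually_lt_const hε)
  refine ⟨n₀ + t₀, fun t ht => ?_⟩
  have h1 := hbound (t - t₀)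
  have h2 := hn₀ (t - t₀) (by omega)
  rw [Nat.sub_add_cancel (by omega)] at h1
  linarith

/-- Running maximum, at least one, of the sup norms of a sequence of vectors. -/
noncomputable def runningNorm {P : Type*} (x : ℕ → P → ℝ) : ℕ → ℝ :=
  partialSups fun t => max 1 (⨆ p, |x t p|)

section Path

variable {P : Type*} {x : ℕ → P → ℝ}

theorem runningNorm_mono : Monotone (runningNorm x) := (partialSups _).monotone

theorem one_le_runningNorm (t : ℕ) : 1 ≤ runningNorm x t :=
  (le_max_left _ _).trans (le_partialSups (fun t => max 1 (⨆ p, |x t p|)) t)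

theorem iSup_abs_le_runningNorm (t : ℕ) : ⨆ p, |x t p| ≤ runningNorm x t :=
  (le_max_right _ _).trans (le_partialSups (fun t => max 1 (⨆ p, |x t p|)) t)

theorem abs_le_iSup_abs [Finite P] (f : P → ℝ) (p : P) : |f p| ≤ ⨆ p, |f p| :=
  le_ciSup (f := fun p => |f p|) (Set.finite_range _).bddAbove p

variable {g m r : ℕ → P → ℝ} {δ : ℝ}

theorem relaxation_step (hg : ∀ t p, g t p ∈ Set.Icc (0 : ℝ) 1)
    (hm : ∀ t p, |m t p| ≤ δ * ⨆ p, |x t p|)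
    (hx : ∀ t p, x (t + 1) p = (1 - g t p) * x t p + g t p * m t p
      + runningNorm x t * (r (t + 1) p - r t p)) {η : ℝ} {t : ℕ} {p : P}
    (hr : |r t p| ≤ η) (hr' : |r (t + 1) p| ≤ η) :
    |x (t + 1) p - runningNorm x (t + 1) * r (t + 1) p| ≤
      (1 - g t p) * |x t p - runningNorm x t * r t p|
        + g t p * (δ * (⨆ p, |x t p|) + runningNorm x t * η)
        + η * (runningNorm x (t + 1) - runningNorm x t) := by
  have hB := one_le_runningNorm (x := x) t
  have hB' := runningNorm_mono (x := x) (Nat.le_succ t)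
  obtain ⟨h0, h1⟩ := hg t p
  have e : x (t + 1) p - runningNorm x (t + 1) * r (t + 1) p =
      (1 - g t p) * (x t p - runningNorm x t * r t p)
        + g t p * (m t p - runningNorm x t * r t p)
        - (runningNorm x (t + 1) - runningNorm x t) * r (t + 1) p := by
    rw [hx]; ring
  have a1 : |m t p - runningNorm x t * r t p| ≤
      δ * (⨆ p, |x t p|) + runningNorm x t * η := by
    refine (abs_sub _ _).trans (add_le_add (hm t p) ?_)
    rw [abs_mul, abs_of_nonneg (by linarith)]
    exact mul_le_mul_of_nonneg_left hr (by linarith)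
  have a2 : |(runningNorm x (t + 1) - runningNorm x t) * r (t + 1) p| ≤
      η * (runningNorm x (t + 1) - runningNorm x t) := by
    rw [abs_mul, abs_of_nonneg (sub_nonneg.2 hB'), mul_comm]
    exact mul_le_mul_of_nonneg_right hr' (sub_nonneg.2 hB')
  rw [e]
  refine (abs_sub _ _).trans (add_le_add ((abs_add_le _ _).trans ?_) a2)
  rw [abs_mul, abs_mul, abs_of_nonneg h0, abs_of_nonneg (sub_nonneg.2 h1)]
  gcongr

variable [Finite P] [Nonempty P]

theorem exists_runningNorm_le (hδ0 : 0 ≤ δ) (hδ1 : δ < 1)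
    (hg : ∀ t p, g t p ∈ Set.Icc (0 : ℝ) 1)
    (hm : ∀ t p, |m t p| ≤ δ * ⨆ p, |x t p|)
    (hx : ∀ t p, x (t + 1) p = (1 - g t p) * x t p + g t p * m t p
      + runningNorm x t * (r (t + 1) p - r t p))
    (hr : ∀ p, Tendsto (fun t => r t p) atTop (nhds 0)) :
    ∃ b, ∀ t, runningNorm x t ≤ b := by
  set η := (1 - δ) / 4 with hη
  have hη0 : 0 < η := by rw [hη]; linarith
  have hev : ∀ᶠ t in atTop, ∀ p, |r t p| ≤ η := by
    refine eventually_all.2 fun p => ?_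
    have := (hr p).abs
    rw [abs_zero] at this
    exact (this.eventually_lt_const hη0).mono fun _ h => h.le
  obtain ⟨t₀, ht₀⟩ := eventually_atTop.1 hev
  set B := runningNorm x with hBdef
  set K := ⨆ p, |x t₀ p - B t₀ * r t₀ p| with hK
  have hZ : ∀ t, t₀ ≤ t → ∀ p, |x t p - B t * r t p| ≤
      (δ + η) * B t + K + η * (B t - B t₀) := by
    intro t ht p
    induction t, ht using Nat.le_induction with
    | base =>
      have h1 := abs_le_iSup_abs (fun p => x t₀ p - B t₀ * r t₀ p) p
      have h2 := one_le_runningNorm (x := x) t₀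
      have : 0 ≤ (δ + η) * B t₀ := mul_nonneg (by linarith) (by linarith)
      simp only [← hK] at h1
      linarith
    | succ t ht ih =>
      have h1 := relaxation_step hg hm hx (ht₀ t ht p) (ht₀ (t + 1) (by omega) p)
      have hmono : B t ≤ B (t + 1) := runningNorm_mono (Nat.le_succ t)
      have hmono0 : B t₀ ≤ B t := runningNorm_mono ht
      have hD : ⨆ p, |x t p| ≤ B t := iSup_abs_le_runningNorm t
      have hK0 : 0 ≤ K := Real.iSup_nonneg fun p => abs_nonneg _
      obtain ⟨hg0, hg1⟩ := hg t p
      have h2 := mul_le_mul_of_nonneg_left ih (sub_nonneg.2 hg1)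
      have h3 : g t p * (δ * (⨆ p, |x t p|) + B t * η) ≤ g t p * (δ * B t + B t * η) := by
        gcongr
      have h4 : 0 ≤ g t p * (K + η * (B t - B t₀)) :=
        mul_nonneg hg0 (add_nonneg hK0 (mul_nonneg hη0.le (sub_nonneg.2 hmono0)))
      have h5 : (δ + η) * B t ≤ (δ + η) * B (t + 1) := by gcongr
      linarith
  have hB0 : ∀ t, 0 ≤ B t := fun t => zero_le_one.trans (one_le_runningNorm t)
  have hX : ∀ t, t₀ ≤ t → ⨆ p, |x t p| ≤ K + (δ + 3 * η) * B t := by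
    intro t ht
    refine ciSup_le fun p => ?_
    have h1 := hZ t ht p
    have h2 : |B t * r t p| ≤ B t * η := by
      rw [abs_mul, abs_of_nonneg (hB0 t)]
      exact mul_le_mul_of_nonneg_left (ht₀ t ht p) (hB0 t)
    have h3 := abs_sub_abs_le_abs_sub (x t p) (B t * r t p)
    have h4 := mul_nonneg hη0.le (hB0 t₀)
    linarith
  refine ⟨max (B t₀) (K / η), fun t => ?_⟩
  have key : B t ≤ max (B t₀) (K + (1 - η) * B t) := by
    refine partialSups_le _ t _ fun s hs => ?_
    have hsB : B s ≤ B t := runningNorm_mono hs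
    rcases le_total s t₀ with h | h
    · refine le_max_of_le_left ((le_partialSups (fun t => max 1 (⨆ p, |x t p|)) s).trans ?_)
      exact runningNorm_mono h
    · refine max_le (le_max_of_le_left (one_le_runningNorm t₀)) (le_max_of_le_right ?_)
      refine (hX s h).trans ?_
      rw [show 1 - η = δ + 3 * η by rw [hη]; ring]
      gcongr
  rcases le_max_iff.1 key with h | h
  · exact le_max_of_le_left h
  · refine le_max_of_le_right ((le_div_iff₀ hη0).2 ?_)
    linarith

theorem tendsto_zero_of_relaxation (hδ0 : 0 ≤ δ) (hδ1 : δ < 1)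
    (hg : ∀ t p, g t p ∈ Set.Icc (0 : ℝ) 1) (hsum : ∀ p, ¬ Summable fun t => g t p)
    (hm : ∀ t p, |m t p| ≤ δ * ⨆ p, |x t p|)
    (hx : ∀ t p, x (t + 1) p = (1 - g t p) * x t p + g t p * m t p
      + runningNorm x t * (r (t + 1) p - r t p))
    (hr : ∀ p, Tendsto (fun t => r t p) atTop (nhds 0)) (p : P) :
    Tendsto (fun t => x t p) atTop (nhds 0) := by
  obtain ⟨b, hb⟩ := exists_runningNorm_le hδ0 hδ1 hg hm hx hr
  have hb1 : 1 ≤ b := (one_le_runningNorm 0).trans (hb 0)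
  have hb0 : 0 < b := by linarith
  have improve : ∀ L ε : ℝ, 0 < ε → (∀ᶠ t in atTop, ⨆ p, |x t p| ≤ L) →
      ∀ᶠ t in atTop, ⨆ p, |x t p| ≤ δ * L + ε := by
    intro L ε hε hL
    set η := ε / (6 * b) with hη
    have hη0 : 0 < η := by positivity
    have hηb : b * η = ε / 6 := by rw [hη]; field_simp
    have hev : ∀ᶠ t in atTop, ∀ p, |r t p| ≤ η := by
      refine eventually_all.2 fun p => ?_
      have := (hr p).abs
      rw [abs_zero] at this
      exact (this.eventually_lt_const hη0).mono fun _ h => h.le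
    have hp : ∀ p, ∀ᶠ t in atTop, |x t p| ≤ δ * L + ε := by
      intro p
      have hy := eventually_le_of_relaxation (c := δ * L + 2 * (b * η))
        (y := fun t => |x t p - runningNorm x t * r t p| + η * (b - runningNorm x t))
        (fun t => hg t p) (hsum p) ?_ (half_pos hε)
      · filter_upwards [hy, hev] with t h1 h2
        have h3 : |runningNorm x t * r t p| ≤ b * η := by
          rw [abs_mul, abs_of_nonneg (zero_le_one.trans (one_le_runningNorm t))]
          exact mul_le_mul (hb t) (h2 p) (abs_nonneg _) hb0.le
        have h4 := abs_sub_abs_le_abs_sub (x t p) (runningNorm x t * r t p)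
        have h5 := mul_nonneg hη0.le (sub_nonneg.2 (hb t))
        linarith
      · filter_upwards [hL, hev, (tendsto_add_atTop_nat 1).eventually hev] with t h1 h2 h3
        have h4 := relaxation_step hg hm hx (h2 p) (h3 p)
        obtain ⟨hg0, hg1⟩ := hg t p
        have h5 : g t p * (δ * (⨆ p, |x t p|) + runningNorm x t * η) ≤
            g t p * (δ * L + b * η) := by
          have := hb t
          gcongr
        have h6 : 0 ≤ g t p * (η * runningNorm x t) :=
          mul_nonneg hg0 (mul_nonneg hη0.le (zero_le_one.trans (one_le_runningNorm t)))
        linarith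
    filter_upwards [eventually_all.2 hp] with t ht using ciSup_le ht
  have hgeom : ∀ n : ℕ, ∀ᶠ t in atTop, ⨆ p, |x t p| ≤ ((1 + δ) / 2) ^ n * b := by
    intro n
    induction n with
    | zero => exact .of_forall fun t => by simpa using (iSup_abs_le_runningNorm t).trans (hb t)
    | succ n ih =>
      have hL : 0 < ((1 + δ) / 2) ^ n * b := by positivity
      refine (improve _ ((1 - δ) / 2 * (((1 + δ) / 2) ^ n * b))
        (mul_pos (by linarith) hL) ih).mono fun t ht => ht.trans (le_of_eq ?_)
      ring
  have hlim : Tendsto (fun n : ℕ => ((1 + δ) / 2) ^ n * b) atTop (nhds 0) := by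
    simpa using (tendsto_pow_atTop_nhds_zero_of_lt_one (by linarith : 0 ≤ (1 + δ) / 2)
      (by linarith)).mul_const b
  rw [Metric.tendsto_nhds]
  intro ε hε
  obtain ⟨n, hn⟩ := (hlim.eventually_lt_const hε).exists
  filter_upwards [hgeom n] with t ht
  rw [Real.dist_eq, sub_zero]
  exact ((abs_le_iSup_abs _ p).trans ht).trans_lt hn

end Path

theorem measurable_runningNorm {Ω P : Type*} [Finite P] {𝒢 : ℕ → MeasurableSpace Ω}
    (hmono : Monotone 𝒢) {X : ℕ → P → Ω → ℝ} (hX : ∀ t p, Measurable[𝒢 t] (X t p)) (t : ℕ) :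
    Measurable[𝒢 t] fun ω => runningNorm (fun t p => X t p ω) t := by
  have hD : ∀ t, Measurable[𝒢 t] fun ω => max 1 (⨆ p, |X t p ω|) := fun t => by
    let _ := 𝒢 t
    exact measurable_const.max (.iSup fun p => (hX t p).abs)
  induction t with
  | zero => simpa [runningNorm] using hD 0
  | succ t ih =>
    simp only [runningNorm, partialSups_add_one]
    let _ := 𝒢 (t + 1)
    exact (ih.mono (hmono t.le_succ) le_rfl).sup (hD (t + 1))

section Martingale

variable {Ω : Type*} {m₀ : MeasurableSpace Ω} {μ : Measure Ω} [IsProbabilityMeasure μ]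

theorem martingale_sum_of_condExp_eq_zero {𝒢 : Filtration ℕ m₀} {ξ : ℕ → Ω → ℝ}
    (hmeas : ∀ t, StronglyMeasurable[𝒢 (t + 1)] (ξ t)) (hint : ∀ t, Integrable (ξ t) μ)
    (hzero : ∀ t, μ[ξ t|𝒢 t] =ᵐ[μ] 0) :
    Martingale (fun n => ∑ t ∈ Finset.range n, ξ t) 𝒢 μ := by
  refine martingale_of_condExp_sub_eq_zero_nat (fun n => ?_)
    (fun n => integrable_finsetSum' _ fun t _ => hint t) fun n => ?_
  · exact Finset.stronglyMeasurable_sum _ fun t ht =>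
      (hmeas t).mono (𝒢.mono (Finset.mem_range.1 ht))
  · simpa [Finset.sum_range_succ] using hzero n

theorem ae_exists_tendsto_of_sum_integral_sq_le {𝒢 : Filtration ℕ m₀} {ξ : ℕ → Ω → ℝ} {R : ℝ}
    (hmeas : ∀ t, StronglyMeasurable[𝒢 (t + 1)] (ξ t)) (hmem : ∀ t, MemLp (ξ t) 2 μ)
    (hzero : ∀ t, μ[ξ t|𝒢 t] =ᵐ[μ] 0)
    (hR : ∀ n, ∑ t ∈ Finset.range n, ∫ ω, ξ t ω ^ 2 ∂μ ≤ R) :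
    ∀ᵐ ω ∂μ, ∃ l, Tendsto (fun n => ∑ t ∈ Finset.range n, ξ t ω) atTop (nhds l) := by
  set M : ℕ → Ω → ℝ := fun n => ∑ t ∈ Finset.range n, ξ t with hM
  have hmart : Martingale M 𝒢 μ :=
    martingale_sum_of_condExp_eq_zero hmeas (fun t => (hmem t).integrable one_le_two) hzero
  have hML : ∀ n, MemLp (M n) 2 μ := fun n => memLp_finsetSum' _ fun t _ => hmem t
  have hsq : ∀ n, ∫ ω, M n ω ^ 2 ∂μ = ∑ t ∈ Finset.range n, ∫ ω, ξ t ω ^ 2 ∂μ := by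
    intro n
    induction n with
    | zero => simp [hM]
    | succ n ih =>
      have hprod : Integrable (M n * ξ n) μ := (hML n).integrable_mul (hmem n)
      have hcross : ∫ ω, (M n * ξ n) ω ∂μ = 0 := by
        rw [← integral_condExp (𝒢.le n)]
        refine integral_eq_zero_of_ae ?_
        filter_upwards [condExp_mul_of_stronglyMeasurable_left (hmart.stronglyMeasurable n) hprod
          ((hmem n).integrable one_le_two), hzero n] with ω h1 h2
        simp [h1, h2]
      rw [Finset.sum_range_succ, ← ih]
      have e : (fun ω => M (n + 1) ω ^ 2) =
          fun ω => M n ω ^ 2 + (2 * (M n * ξ n) ω + ξ n ω ^ 2) := by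
        funext ω
        simp only [hM, Finset.sum_range_succ, Pi.add_apply, Pi.mul_apply]
        ring
      have hrest : Integrable (fun ω => 2 * (M n * ξ n) ω + ξ n ω ^ 2) μ :=
        (hprod.const_mul 2).add (hmem n).integrable_sq
      rw [e, integral_add (hML n).integrable_sq hrest,
        integral_add (hprod.const_mul 2) (hmem n).integrable_sq, integral_const_mul, hcross]
      ring
  have hbdd : ∀ n, eLpNorm (M n) 1 μ ≤ (Real.toNNReal (1 + R) : ENNReal) := by
    intro n
    have hi := (hML n).integrable one_le_two
    rw [eLpNorm_one_eq_lintegral_enorm, ← ofReal_integral_norm_eq_lintegral_enorm hi]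
    refine ENNReal.ofReal_le_ofReal ?_
    calc ∫ ω, ‖M n ω‖ ∂μ ≤ ∫ ω, (1 + M n ω ^ 2) ∂μ := by
          refine integral_mono hi.norm ((integrable_const 1).add (hML n).integrable_sq)
            fun ω => ?_
          rw [Real.norm_eq_abs]
          nlinarith [sq_abs (M n ω), sq_nonneg (|M n ω| - 1), abs_nonneg (M n ω)]
      _ = 1 + ∫ ω, M n ω ^ 2 ∂μ := by
          rw [integral_add (integrable_const 1) (hML n).integrable_sq]; simp
      _ ≤ 1 + R := by rw [hsq]; linarith [hR n]
  simpa [hM] using hmart.submartingale.exists_ae_tendsto_of_bdd hbdd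

theorem ae_exists_tendsto_of_sum_sq_le {𝒢 : Filtration ℕ m₀} {c v : ℕ → Ω → ℝ} {K N : ℝ}
    (hc : ∀ t, StronglyMeasurable[𝒢 t] (c t))
    (hv : ∀ t, StronglyMeasurable[𝒢 (t + 1)] (v t)) (hmem : ∀ t, MemLp (v t) 2 μ)
    (hzero : ∀ t, μ[v t|𝒢 t] =ᵐ[μ] 0) (hK : ∀ t, μ[v t ^ 2|𝒢 t] ≤ᵐ[μ] fun _ => K)
    (hcN : ∀ n ω, ∑ t ∈ Finset.range n, c t ω ^ 2 ≤ N) :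
    ∀ᵐ ω ∂μ, ∃ l, Tendsto (fun n => ∑ t ∈ Finset.range n, c t ω * v t ω) atTop (nhds l) := by
  have hsq : ∀ t ω, c t ω ^ 2 ≤ N := fun t ω =>
    (Finset.single_le_sum (f := fun t => c t ω ^ 2) (fun i _ => sq_nonneg _)
      (Finset.self_mem_range_succ t)).trans (hcN (t + 1) ω)
  have hbd : ∀ t ω, ‖c t ω‖ ≤ Real.sqrt N := fun t ω => Real.abs_le_sqrt (hsq t ω)
  have hcm : ∀ t, AEStronglyMeasurable (c t) μ := fun t =>
    ((hc t).mono (𝒢.le t)).aestronglyMeasurable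
  have hξ : ∀ t, MemLp (c t * v t) 2 μ := fun t =>
    (hmem t).mul (memLp_top_of_bound (hcm t) _ (.of_forall (hbd t)))
  have hc2 : ∀ t, Integrable (fun ω => c t ω ^ 2) μ := fun t =>
    (memLp_top_of_bound (hcm t) _ (.of_forall (hbd t)) |>.mono_exponent le_top).integrable_sq
  refine ae_exists_tendsto_of_sum_integral_sq_le (𝒢 := 𝒢) (ξ := fun t => c t * v t)
    (R := |K| * N) (fun t => ((hc t).mono (𝒢.mono t.le_succ)).mul (hv t)) hξ (fun t => ?_)
    fun n => ?_
  · filter_upwards [condExp_mul_of_stronglyMeasurable_left (hc t)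
      ((hξ t).integrable one_le_two) ((hmem t).integrable one_le_two), hzero t] with ω h1 h2
    simp [h1, h2]
  · have hstep : ∀ t, ∫ ω, (c t * v t) ω ^ 2 ∂μ ≤ ∫ ω, |K| * c t ω ^ 2 ∂μ := by
      intro t
      have hi : Integrable (c t ^ 2 * v t ^ 2) μ := by
        rw [← mul_pow]; exact (hξ t).integrable_sq
      have e : ∫ ω, (c t * v t) ω ^ 2 ∂μ = ∫ ω, (μ[c t ^ 2 * v t ^ 2|𝒢 t]) ω ∂μ := by
        rw [integral_condExp (𝒢.le t), ← mul_pow]; rfl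
      rw [e]
      refine integral_mono_ae integrable_condExp ((hc2 t).const_mul _) ?_
      filter_upwards [condExp_mul_of_stronglyMeasurable_left ((hc t).pow 2) hi
        (hmem t).integrable_sq, hK t] with ω h1 h2
      rw [h1]
      have h3 : (μ[v t ^ 2|𝒢 t]) ω ≤ |K| := h2.trans (le_abs_self K)
      simpa [mul_comm] using mul_le_mul_of_nonneg_left h3 (sq_nonneg (c t ω))
    refine (Finset.sum_le_sum fun t _ => hstep t).trans ?_
    rw [← integral_finsetSum _ fun t _ => (hc2 t).const_mul |K|]
    calc _ ≤ ∫ _, |K| * N ∂μ := by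
          refine integral_mono (integrable_finsetSum _ fun t _ => (hc2 t).const_mul |K|)
            (integrable_const _) fun ω => ?_
          simp only [← Finset.mul_sum]
          exact mul_le_mul_of_nonneg_left (hcN n ω) (abs_nonneg K)
      _ = |K| * N := by simp

theorem ae_exists_tendsto_of_summable_sq {𝒢 : Filtration ℕ m₀} {c v : ℕ → Ω → ℝ} {K : ℝ}
    (hc : ∀ t, StronglyMeasurable[𝒢 t] (c t))
    (hv : ∀ t, StronglyMeasurable[𝒢 (t + 1)] (v t)) (hmem : ∀ t, MemLp (v t) 2 μ)
    (hzero : ∀ t, μ[v t|𝒢 t] =ᵐ[μ] 0) (hK : ∀ t, μ[v t ^ 2|𝒢 t] ≤ᵐ[μ] fun _ => K)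
    (hsum : ∀ᵐ ω ∂μ, Summable fun t => c t ω ^ 2) :
    ∀ᵐ ω ∂μ, ∃ l, Tendsto (fun n => ∑ t ∈ Finset.range n, c t ω * v t ω) atTop (nhds l) := by
  let s : ℕ → ℕ → Set Ω := fun N t => {ω | ∑ i ∈ Finset.range (t + 1), c i ω ^ 2 ≤ N}
  have hs : ∀ N t, MeasurableSet[𝒢 t] (s N t) := fun N t => by
    refine StronglyMeasurable.measurableSet_le ?_ stronglyMeasurable_const
    exact Finset.stronglyMeasurable_fun_sum _ fun i hi =>
      ((hc i).mono (𝒢.mono (Nat.lt_succ_iff.1 (Finset.mem_range.1 hi)))).pow 2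
  have hle : ∀ N : ℕ, ∀ n ω, ∑ t ∈ Finset.range n, (s N t).indicator (c t) ω ^ 2 ≤ (N : ℝ) := by
    intro N n ω
    induction n with
    | zero => simp
    | succ n ih =>
      by_cases h : ω ∈ s N n
      · refine (Finset.sum_le_sum fun t _ => ?_).trans h
        by_cases h' : ω ∈ s N t
        · rw [Set.indicator_of_mem h']
        · rw [Set.indicator_of_notMem h']; simpa using sq_nonneg (c t ω)
      · rw [Finset.sum_range_succ, Set.indicator_of_notMem h]
        simpa using ih
  have hloc := ae_all_iff.2 fun N : ℕ => ae_exists_tendsto_of_sum_sq_le (μ := μ) (N := N)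
    (fun t => (hc t).indicator (hs N t)) hv hmem hzero hK (hle N)
  filter_upwards [hloc, hsum] with ω h1 h2
  obtain ⟨N, hN⟩ := exists_nat_ge (∑' t, c t ω ^ 2)
  have hmem' : ∀ t, ω ∈ s N t := fun t =>
    (h2.sum_le_tsum _ fun i _ => sq_nonneg (c i ω)).trans hN
  simpa [Set.indicator_of_mem (hmem' _)] using h1 N

end Martingale

/-- **Convergence lemma from stochastic approximation theory.**
If `Δ_{t+1}(p) = (1 − γ_t(p)) Δ_t(p) + γ_t(p) F_t(p)` a.s. for processes that
are adapted to an increasing family of σ-algebras `𝒢_t`, the learning rates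
satisfy the Robbins–Monro conditions, the conditional means of `F_t` contract
(`‖E[F_t | 𝒢_t]‖_∞ ≤ δ ‖Δ_t‖_∞` for some `δ ∈ (0,1)`), and the conditional
variances grow at most as `C (1 + ‖Δ_t‖_∞)²`, then `Δ_t(p) → 0` a.s. for
every index `p`. -/
theorem stochastic_approximation_convergence
    {Ω : Type} [MeasurableSpace Ω] (ℙ : Measure Ω) [IsProbabilityMeasure ℙ]
    {S A : Type} [Fintype S] [Nonempty S] [Fintype A] [Nonempty A]
    (γ F Δ : ℕ → S × A → Ω → ℝ)
    (𝒢 : ℕ → MeasurableSpace Ω)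
    (h𝒢mono : Monotone 𝒢) (h𝒢le : ∀ t, 𝒢 t ≤ ‹MeasurableSpace Ω›)
    (hmeas0 : ∀ p : S × A, Measurable[𝒢 0] (Δ 0 p) ∧ Measurable[𝒢 0] (γ 0 p))
    (hmeas : ∀ (t : ℕ) (p : S × A),
      Measurable[𝒢 (t + 1)] (Δ (t + 1) p) ∧ Measurable[𝒢 (t + 1)] (γ (t + 1) p) ∧
        Measurable[𝒢 (t + 1)] (F t p))
    (hint : ∀ (t : ℕ) (p : S × A),
      Integrable (F t p) ℙ ∧ Integrable (fun ω => (F t p ω) ^ 2) ℙ)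
    (hrec : ∀ (t : ℕ), ∀ᵐ ω ∂ℙ, ∀ p : S × A,
      Δ (t + 1) p ω = (1 - γ t p ω) * Δ t p ω + γ t p ω * F t p ω)
    (hγ : ∀ p : S × A, ∀ᵐ ω ∂ℙ,
      (∀ t, γ t p ω ∈ Set.Icc (0 : ℝ) 1) ∧
        (∑' t : ℕ, ENNReal.ofReal (γ t p ω) = ⊤) ∧
        Summable fun t : ℕ => (γ t p ω) ^ 2)
    (hδ : ∃ δ ∈ Set.Ioo (0 : ℝ) 1, ∀ t : ℕ, ∀ᵐ ω ∂ℙ,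
      (⨆ p : S × A, |(ℙ[F t p|𝒢 t]) ω|) ≤ δ * ⨆ p : S × A, |Δ t p ω|)
    (hC : ∃ C > (0 : ℝ), ∀ t : ℕ, ∀ᵐ ω ∂ℙ,
      (⨆ p : S × A,
          |(ℙ[fun ω' => (F t p ω') ^ 2|𝒢 t]) ω - ((ℙ[F t p|𝒢 t]) ω) ^ 2|) ≤
        C * (1 + ⨆ p : S × A, |Δ t p ω|) ^ 2) :
    ∀ p : S × A, ∀ᵐ ω ∂ℙ,
      Tendsto (fun t => Δ t p ω) atTop (nhds 0) := by
  intro p₀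
  obtain ⟨δ, ⟨hδ0, hδ1⟩, hδ⟩ := hδ
  obtain ⟨C, hC0, hC⟩ := hC
  have hΔ : ∀ t p, Measurable[𝒢 t] (Δ t p) := fun t p => by
    cases t with
    | zero => exact (hmeas0 p).1
    | succ t => exact (hmeas t p).1
  have hγm : ∀ t p, Measurable[𝒢 t] (γ t p) := fun t p => by
    cases t with
    | zero => exact (hmeas0 p).2
    | succ t => exact (hmeas t p).2.1
  have hF2 : ∀ t p, MemLp (F t p) 2 ℙ := fun t p =>
    (memLp_two_iff_integrable_sq (hint t p).1.aestronglyMeasurable).2 (hint t p).2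
  let ℱ : Filtration ℕ ‹MeasurableSpace Ω› := ⟨𝒢, h𝒢mono, h𝒢le⟩
  let B : ℕ → Ω → ℝ := fun t ω => runningNorm (fun t p => Δ t p ω) t
  have hB1 : ∀ t ω, 1 ≤ B t ω := fun t ω => one_le_runningNorm t
  have hBm : ∀ t, StronglyMeasurable[𝒢 t] (B t)⁻¹ := fun t =>
    (measurable_runningNorm h𝒢mono hΔ t).inv.stronglyMeasurable
  let w : ℕ → S × A → Ω → ℝ := fun t p => F t p - ℙ[F t p|𝒢 t]
  have hw2 : ∀ t p, MemLp (w t p) 2 ℙ := fun t p => (hF2 t p).sub ((hF2 t p).condExp one_le_two)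
  have hv2 : ∀ t p, MemLp ((B t)⁻¹ * w t p) 2 ℙ := fun t p =>
    (hw2 t p).mul (memLp_top_of_bound ((hBm t).mono (h𝒢le t)).aestronglyMeasurable 1
      (.of_forall fun ω => by
        rw [Pi.inv_apply, norm_inv, Real.norm_of_nonneg (zero_le_one.trans (hB1 t ω))]
        exact inv_le_one_of_one_le₀ (hB1 t ω)))
  have hw0 : ∀ t p, ℙ[w t p|𝒢 t] =ᵐ[ℙ] 0 := fun t p => by
    filter_upwards [condExp_sub (hint t p).1 (integrable_condExp (m := 𝒢 t) (f := F t p)) (𝒢 t)]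
      with ω h
    rw [h, condExp_of_stronglyMeasurable (h𝒢le t) stronglyMeasurable_condExp integrable_condExp]
    simp
  have hv0 : ∀ t p, ℙ[(B t)⁻¹ * w t p|𝒢 t] =ᵐ[ℙ] 0 := fun t p => by
    filter_upwards [condExp_mul_of_stronglyMeasurable_left (hBm t)
      ((hv2 t p).integrable one_le_two) ((hw2 t p).integrable one_le_two), hw0 t p] with ω h1 h2
    simp [h1, h2]
  have hvK : ∀ t p, ℙ[((B t)⁻¹ * w t p) ^ 2|𝒢 t] ≤ᵐ[ℙ] fun _ => 4 * C := fun t p => by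
    have hi := (hv2 t p).integrable_sq
    have hi' : Integrable ((B t)⁻¹ ^ 2 * w t p ^ 2) ℙ := by rw [← mul_pow]; exact hi
    rw [mul_pow]
    filter_upwards [condExp_mul_of_stronglyMeasurable_left ((hBm t).pow 2) hi'
      (hw2 t p).integrable_sq, hC t,
      ProbabilityTheory.condVar_ae_eq_condExp_sq_sub_sq_condExp (h𝒢le t) (hF2 t p)]
      with ω h1 h2 h3
    have hvar : (ℙ[w t p ^ 2|𝒢 t]) ω ≤ C * (1 + ⨆ p, |Δ t p ω|) ^ 2 := by
      refine le_trans (le_of_eq h3) ((le_abs_self _).trans ?_)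
      exact (abs_le_iSup_abs (fun p => (ℙ[fun ω' => F t p ω' ^ 2|𝒢 t]) ω -
        (ℙ[F t p|𝒢 t]) ω ^ 2) p).trans h2
    have hD : ⨆ p, |Δ t p ω| ≤ B t ω := iSup_abs_le_runningNorm (x := fun t p => Δ t p ω) t
    have hD0 : 0 ≤ ⨆ p, |Δ t p ω| := Real.iSup_nonneg fun p => abs_nonneg _
    have hB := hB1 t ω
    have hle : (1 + ⨆ p, |Δ t p ω|) ^ 2 ≤ (2 * B t ω) ^ 2 := by gcongr; linarith
    rw [h1, Pi.mul_apply, Pi.pow_apply, Pi.inv_apply, inv_pow, inv_mul_le_iff₀ (by positivity)]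
    nlinarith
  have hconv : ∀ᵐ ω ∂ℙ, ∀ p, ∃ l, Tendsto
      (fun n => ∑ t ∈ Finset.range n, γ t p ω * ((B t)⁻¹ * w t p) ω) atTop (nhds l) :=
    ae_all_iff.2 fun p => ae_exists_tendsto_of_summable_sq (𝒢 := ℱ)
      (fun t => (hγm t p).stronglyMeasurable)
      (fun t => ((hBm t).mono (h𝒢mono t.le_succ)).mul
        ((hmeas t p).2.2.stronglyMeasurable.sub
          (stronglyMeasurable_condExp.mono (h𝒢mono t.le_succ))))
      (fun t => hv2 t p) (fun t => hv0 t p) (fun t => hvK t p) ((hγ p).mono fun ω h => h.2.2)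
  filter_upwards [hconv, ae_all_iff.2 hrec, ae_all_iff.2 hγ, ae_all_iff.2 hδ]
    with ω h1 h2 h3 h4
  choose l hl using h1
  refine tendsto_zero_of_relaxation (x := fun t p => Δ t p ω) (g := fun t p => γ t p ω)
    (m := fun t p => (ℙ[F t p|𝒢 t]) ω)
    (r := fun n p => ∑ t ∈ Finset.range n, γ t p ω * ((B t)⁻¹ * w t p) ω - l p)
    hδ0.le hδ1 (fun t p => (h3 p).1 t) (fun p hsum => hsum.tsum_ofReal_ne_top (h3 p).2.1)
    (fun t p => (abs_le_iSup_abs _ p).trans (h4 t)) (fun t p => ?_) (fun p => ?_) p₀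
  · have hB : B t ω ≠ 0 := (zero_lt_one.trans_le (hB1 t ω)).ne'
    change _ = _ + B t ω * _
    rw [h2, Finset.sum_range_succ]
    simp only [w, Pi.mul_apply, Pi.inv_apply, Pi.sub_apply]
    field_simp
    ring
  · simpa using (hl p).sub_const (l p)
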